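/- Let s∈(0,1) and let K satisfy (K1) and (K2). Let C̄, κ ∈ (0,∞) and σ, τ ∈ (1,∞). Let φ ∈ C^{1,1}(ℝ) be such that φ(x) ≥ C̄|x|^{−σ} for x < −κ and φ(x) ≥ C̄|x|^{−τ} for x > κ, and such that φ(x) ≥ γ for all x ∈ [−κ,κ], for some γ ∈ (0,∞). Suppose moreover that |x|·φ(x) → 0 as x → ±∞, that x³‖φ″‖_{L^∞(x/2,3x/2)} → 0 as x → +∞ and |x|³‖φ″‖_{L^∞(3x/2,x/2)} → 0 as x → −∞. Then liminf_{|x|→+∞} |x|^{1+2s} L_K φ(x) ≥ λ·( C̄κ^{1−σ}/(σ−1) + ∫_{−κ}^{κ} φ(y) dy + C̄κ^{1−τ}/(τ−1) ), where λ is the constant in (K2). -/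

import Mathlib

open MeasureTheory Filter Set Topology

/-- The principal value operator `L_K u (x)` (junk value if the limit does not exist). -/
noncomputable def LK (K u : ℝ → ℝ) (x : ℝ) : ℝ :=
  limUnder (nhdsWithin (0:ℝ) (Set.Ioi 0))
    (fun ε : ℝ => ∫ y in {y : ℝ | ε < |y - x|}, (u y - u x) * K (x - y))

/-- A second difference is controlled by the Lipschitz seminorm of the derivative. -/
theorem abs_second_difference_le {φ : ℝ → ℝ} (hφ : Differentiable ℝ φ) {x z S : ℝ} (hz : 0 < z)
    (hS : ∀ a ∈ Ioo (x - z) (x + z), ∀ b ∈ Ioo (x - z) (x + z),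
      |deriv φ a - deriv φ b| ≤ S * |a - b|) :
    |φ (x + z) + φ (x - z) - 2 * φ x| ≤ 2 * S * z ^ 2 := by
  obtain ⟨a, ha, hae⟩ := exists_deriv_eq_slope φ (show x < x + z by linarith)
    hφ.continuous.continuousOn hφ.differentiableOn
  obtain ⟨b, hb, hbe⟩ := exists_deriv_eq_slope φ (show x - z < x by linarith)
    hφ.continuous.continuousOn hφ.differentiableOn
  rw [add_sub_cancel_left, eq_div_iff hz.ne'] at hae
  rw [sub_sub_cancel, eq_div_iff hz.ne'] at hbe
  have hab := hS a ⟨by linarith [ha.1], ha.2⟩ b ⟨hb.1, by linarith [hb.2]⟩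
  have hlt : b < a := hb.2.trans ha.1
  have hS0 : 0 ≤ S := by
    by_contra h
    have : S * |a - b| < 0 := mul_neg_of_neg_of_pos (not_le.1 h) (abs_pos.2 (by linarith))
    linarith [abs_nonneg (deriv φ a - deriv φ b)]
  have hle : |a - b| ≤ 2 * z := by
    rw [abs_of_pos (by linarith)]; linarith [ha.2, hb.1]
  have he : φ (x + z) + φ (x - z) - 2 * φ x = (deriv φ a - deriv φ b) * z := by
    rw [sub_mul, hae, hbe]; ring
  rw [he, abs_mul, abs_of_pos hz]
  calc |deriv φ a - deriv φ b| * z ≤ (S * |a - b|) * z := by gcongr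
    _ ≤ (S * (2 * z)) * z := by gcongr
    _ = 2 * S * z ^ 2 := by ring

/-- A function dominated by an integrable power is integrable on `(a, ∞)`. -/
theorem integrableOn_Ioi_of_abs_le_rpow {K : ℝ → ℝ} (hK : Measurable K) {p Lam a : ℝ}
    (hp : 1 < p) (ha : 0 < a) (hub : ∀ᵐ z : ℝ, 0 < z → |K z| ≤ Lam * z ^ (-p)) :
    IntegrableOn K (Ioi a) := by
  refine Integrable.mono' ((integrableOn_Ioi_rpow_of_lt (a := -p) (by linarith) ha).const_mul Lam)
    hK.aestronglyMeasurable ?_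
  rw [ae_restrict_iff' measurableSet_Ioi]
  filter_upwards [hub] with z hz hza
  exact hz (ha.trans hza)

theorem setIntegral_Ioi_le_of_abs_le_rpow {K : ℝ → ℝ} (hK : Measurable K) {p Lam a : ℝ}
    (hp : 1 < p) (ha : 0 < a) (hub : ∀ᵐ z : ℝ, 0 < z → |K z| ≤ Lam * z ^ (-p)) :
    ∫ z in Ioi a, K z ≤ Lam * (a ^ (1 - p) / (p - 1)) := by
  have h1 : ∫ z in Ioi a, Lam * z ^ (-p) = Lam * (a ^ (1 - p) / (p - 1)) := by
    rw [integral_const_mul, integral_Ioi_rpow_of_lt (by linarith) ha, neg_add_eq_sub,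
      ← neg_sub p 1, div_neg, neg_div, neg_neg]
  rw [← h1]
  refine setIntegral_mono_on_ae (integrableOn_Ioi_of_abs_le_rpow hK hp ha hub)
    ((integrableOn_Ioi_rpow_of_lt (by linarith) ha).const_mul Lam) measurableSet_Ioi ?_
  filter_upwards [hub] with z hz hza
  exact (le_abs_self _).trans (hz (ha.trans hza))

/-- Pointwise bound for a second difference against a singular kernel. -/
theorem abs_second_difference_mul_le {φ K : ℝ → ℝ} (hφ : Differentiable ℝ φ) {x z S p Lam : ℝ}
    (hz : 0 < z) (hS : ∀ a ∈ Ioo (x - z) (x + z), ∀ b ∈ Ioo (x - z) (x + z),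
      |deriv φ a - deriv φ b| ≤ S * |a - b|) (hKz : |K z| ≤ Lam * z ^ (-p)) :
    |(φ (x + z) + φ (x - z) - 2 * φ x) * K z| ≤ 2 * S * Lam * z ^ (2 - p) := by
  have h := abs_second_difference_le hφ hz hS
  calc |(φ (x + z) + φ (x - z) - 2 * φ x) * K z| ≤ (2 * S * z ^ 2) * (Lam * z ^ (-p)) := by
        rw [abs_mul]
        exact mul_le_mul h hKz (abs_nonneg _) ((abs_nonneg _).trans h)
    _ = 2 * S * Lam * (z ^ (2 : ℝ) * z ^ (-p)) := by rw [Real.rpow_two]; ring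
    _ = 2 * S * Lam * z ^ (2 - p) := by rw [← Real.rpow_add hz, sub_eq_add_neg]

theorem integrableOn_Ioc_rpow_zero {r b : ℝ} (hr : -1 < r) (hb : 0 ≤ b) :
    IntegrableOn (fun z : ℝ => z ^ r) (Ioc 0 b) :=
  (intervalIntegrable_iff_integrableOn_Ioc_of_le hb).1
    (intervalIntegral.intervalIntegrable_rpow' hr)

theorem integrableOn_second_difference_mul {φ K : ℝ → ℝ} (hφ : Differentiable ℝ φ) {L M p Lam : ℝ}
    (hL : ∀ a b : ℝ, |deriv φ a - deriv φ b| ≤ L * |a - b|) (hM : ∀ y, |φ y| ≤ M)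
    (hK : Measurable K) (hp : 1 < p) (hp3 : p < 3)
    (hub : ∀ᵐ z : ℝ, 0 < z → |K z| ≤ Lam * z ^ (-p)) (x : ℝ) :
    IntegrableOn (fun z => (φ (x + z) + φ (x - z) - 2 * φ x) * K z) (Ioi 0) := by
  have hφm : Measurable φ := hφ.continuous.measurable
  rw [← Ioc_union_Ioi_eq_Ioi zero_le_one]
  refine IntegrableOn.union ?_ ?_
  · refine Integrable.mono' ((integrableOn_Ioc_rpow_zero (r := 2 - p) (by linarith)
      zero_le_one).const_mul (2 * L * Lam)) (by fun_prop) ?_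
    rw [ae_restrict_iff' measurableSet_Ioc]
    filter_upwards [hub] with z hz hz1
    exact abs_second_difference_mul_le hφ hz1.1 (fun a _ b _ => hL a b) (hz hz1.1)
  · refine Integrable.bdd_mul (c := 4 * M) (integrableOn_Ioi_of_abs_le_rpow hK hp one_pos hub)
      (by fun_prop) (ae_of_all _ fun z => ?_)
    have h1 := abs_le.1 (hM (x + z))
    have h2 := abs_le.1 (hM (x - z))
    have h3 := abs_le.1 (hM x)
    rw [Real.norm_eq_abs, abs_le]
    constructor <;> linarith

/-- The truncated operator as an integral of second differences. -/
theorem truncated_integral_eq {φ K : ℝ → ℝ} (hφ : Continuous φ) {M p Lam : ℝ}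
    (hM : ∀ y, |φ y| ≤ M) (hK : Measurable K) (heven : ∀ᵐ z : ℝ, K (-z) = K z) (hp : 1 < p)
    (hub : ∀ᵐ z : ℝ, 0 < z → |K z| ≤ Lam * z ^ (-p)) (x : ℝ) {ε : ℝ} (hε : 0 < ε) :
    ∫ y in {y : ℝ | ε < |y - x|}, (φ y - φ x) * K (x - y) =
      ∫ z in Ioi ε, (φ (x + z) + φ (x - z) - 2 * φ x) * K z := by
  have hφm : Measurable φ := hφ.measurable
  have hKi := integrableOn_Ioi_of_abs_le_rpow hK hp hε hub
  have hbd : ∀ y, ‖φ y - φ x‖ ≤ 2 * M := fun y => by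
    have h1 := abs_le.1 (hM y)
    have h3 := abs_le.1 (hM x)
    rw [Real.norm_eq_abs, abs_le]
    constructor <;> linarith
  have hset : {y : ℝ | ε < |y - x|} = Iio (x - ε) ∪ Ioi (x + ε) := by
    ext y
    simp only [mem_ofPred_eq, lt_abs, mem_union, mem_Iio, mem_Ioi]
    constructor <;> rintro (h | h)
    · right; linarith
    · left; linarith
    · right; linarith
    · left; linarith
  have hdisj : Disjoint (Iio (x - ε)) (Ioi (x + ε)) :=
    disjoint_left.2 fun y hy hy' => by
      simp only [mem_Iio, mem_Ioi] at hy hy'; linarith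
  have mp1 := measurePreserving_add_left (volume : Measure ℝ) x
  have me1 := measurableEmbedding_addLeft x
  have mp2 := Measure.measurePreserving_sub_left (volume : Measure ℝ) x
  have me2 := (MeasurableEquiv.subLeft x).measurableEmbedding
  have pre1 : (fun z => x + z) ⁻¹' Ioi (x + ε) = Ioi ε := by ext; simp
  have pre2 : (fun z => x - z) ⁻¹' Iio (x - ε) = Ioi ε := by ext; simp
  have hae : ∀ᵐ z ∂(volume.restrict (Ioi ε)), (φ (x + z) - φ x) * K (x - (x + z))
      = (φ (x + z) - φ x) * K z := by
    refine ae_restrict_of_ae ?_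
    filter_upwards [heven] with z hz
    rw [sub_add_cancel_left, hz]
  have i1' : IntegrableOn (fun z => (φ (x + z) - φ x) * K z) (Ioi ε) :=
    Integrable.bdd_mul hKi (by fun_prop) (ae_of_all _ fun z => hbd _)
  have i2' : IntegrableOn (fun z => (φ (x - z) - φ x) * K z) (Ioi ε) :=
    Integrable.bdd_mul hKi (by fun_prop) (ae_of_all _ fun z => hbd _)
  have i1 : IntegrableOn (fun y => (φ y - φ x) * K (x - y)) (Ioi (x + ε)) := by
    rw [← mp1.integrableOn_comp_preimage me1, pre1]
    exact i1'.congr (hae.mono fun z hz => hz.symm)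
  have i2 : IntegrableOn (fun y => (φ y - φ x) * K (x - y)) (Iio (x - ε)) := by
    rw [← mp2.integrableOn_comp_preimage me2, pre2]
    simpa [Function.comp_def] using i2'
  rw [hset, setIntegral_union hdisj measurableSet_Ioi i2 i1,
    ← mp1.setIntegral_preimage_emb me1 _ (Ioi (x + ε)),
    ← mp2.setIntegral_preimage_emb me2 _ (Iio (x - ε)), pre1, pre2, integral_congr_ae hae]
  simp only [sub_sub_cancel]
  rw [← integral_add i2' i1']
  congr 1
  ext z
  ring

/-- The principal value exists and is an absolutely convergent integral of second differences. -/
theorem LK_eq_integral {φ K : ℝ → ℝ} (hφ : Differentiable ℝ φ) {L M p Lam : ℝ}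
    (hL : ∀ a b : ℝ, |deriv φ a - deriv φ b| ≤ L * |a - b|) (hM : ∀ y, |φ y| ≤ M)
    (hK : Measurable K) (heven : ∀ᵐ z : ℝ, K (-z) = K z) (hp : 1 < p) (hp3 : p < 3)
    (hub : ∀ᵐ z : ℝ, 0 < z → |K z| ≤ Lam * z ^ (-p)) (x : ℝ) :
    LK K φ x = ∫ z in Ioi 0, (φ (x + z) + φ (x - z) - 2 * φ x) * K z := by
  refine Tendsto.limUnder_eq ?_
  have hcov : AECover (volume.restrict (Ioi (0 : ℝ))) (𝓝[>] (0 : ℝ)) fun ε : ℝ => Ioi ε :=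
    aecover_Ioi_of_Ioi (tendsto_id.mono_left nhdsWithin_le_nhds)
  refine (hcov.integral_tendsto_of_countably_generated
    (integrableOn_second_difference_mul hφ hL hM hK hp hp3 hub x)).congr' ?_
  filter_upwards [self_mem_nhdsWithin] with ε hε
  rw [Measure.restrict_restrict measurableSet_Ioi,
    inter_eq_left.2 (Ioi_subset_Ioi (le_of_lt hε)),
    truncated_integral_eq hφ.continuous hM hK heven hp hub x hε]

theorem near_integral_ge {φ K : ℝ → ℝ} (hφ : Differentiable ℝ φ) {x δ S p Lam : ℝ} (hδ : 0 < δ)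
    (hp3 : p < 3) (hS : ∀ a ∈ Ioo (x - δ) (x + δ), ∀ b ∈ Ioo (x - δ) (x + δ),
      |deriv φ a - deriv φ b| ≤ S * |a - b|)
    (hub : ∀ᵐ z : ℝ, 0 < z → |K z| ≤ Lam * z ^ (-p)) :
    -(2 * S * Lam * (δ ^ (3 - p) / (3 - p))) ≤
      ∫ z in Ioc 0 δ, (φ (x + z) + φ (x - z) - 2 * φ x) * K z := by
  have hint : ∫ z in Ioc 0 δ, z ^ (2 - p) = δ ^ (3 - p) / (3 - p) := by
    rw [← intervalIntegral.integral_of_le hδ.le, integral_rpow (Or.inl (by linarith)),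
      show 2 - p + 1 = 3 - p by ring, Real.zero_rpow (by linarith), sub_zero]
  have h : ‖∫ z in Ioc 0 δ, (φ (x + z) + φ (x - z) - 2 * φ x) * K z‖ ≤
      ∫ z in Ioc 0 δ, 2 * S * Lam * z ^ (2 - p) := by
    refine norm_integral_le_of_norm_le
      ((integrableOn_Ioc_rpow_zero (by linarith) hδ.le).const_mul _) ?_
    rw [ae_restrict_iff' measurableSet_Ioc]
    filter_upwards [hub] with z hz hzδ
    have hsub : Ioo (x - z) (x + z) ⊆ Ioo (x - δ) (x + δ) :=
      Ioo_subset_Ioo (by linarith [hzδ.2]) (by linarith [hzδ.2])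
    exact abs_second_difference_mul_le hφ hzδ.1
      (fun a ha b hb => hS a (hsub ha) b (hsub hb)) (hz hzδ.1)
  rw [integral_const_mul, hint] at h
  exact (abs_le.1 h).1

theorem far_integral_ge {φ K : ℝ → ℝ} (hφ : Continuous φ) (hφ0 : ∀ y, 0 ≤ φ y)
    {M x δ R p lam Lam : ℝ} (hM : ∀ y, |φ y| ≤ M) (hK : Measurable K) (hδ : 0 < δ) (hR : 0 ≤ R)
    (hxR : δ ≤ x - R) (hp : 1 < p) (hlam : 0 ≤ lam)
    (hlb : ∀ᵐ z : ℝ, 0 < z → lam * z ^ (-p) ≤ K z)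
    (hub : ∀ᵐ z : ℝ, 0 < z → |K z| ≤ Lam * z ^ (-p)) :
    lam * (x + R) ^ (-p) * (∫ y in (-R)..R, φ y) - 2 * φ x * (Lam * (δ ^ (1 - p) / (p - 1))) ≤
      ∫ z in Ioi δ, (φ (x + z) + φ (x - z) - 2 * φ x) * K z := by
  have hφm : Measurable φ := hφ.measurable
  have hKi := integrableOn_Ioi_of_abs_le_rpow hK hp hδ hub
  have hKle := setIntegral_Ioi_le_of_abs_le_rpow hK hp hδ hub
  have hi : IntegrableOn (fun z => (φ (x + z) + φ (x - z)) * K z) (Ioi δ) := by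
    refine Integrable.bdd_mul (c := 2 * M) hKi (by fun_prop) (ae_of_all _ fun z => ?_)
    have h1 := abs_le.1 (hM (x + z))
    have h2 := abs_le.1 (hM (x - z))
    rw [Real.norm_eq_abs, abs_le]
    constructor <;> linarith
  have hsub : Ioc (x - R) (x + R) ⊆ Ioi δ := fun z hz => lt_of_le_of_lt hxR hz.1
  have hwindow : lam * (x + R) ^ (-p) * (∫ y in (-R)..R, φ y) =
      ∫ z in Ioc (x - R) (x + R), lam * (x + R) ^ (-p) * φ (x - z) := by
    rw [integral_const_mul, ← intervalIntegral.integral_of_le (by linarith),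
      intervalIntegral.integral_comp_sub_left]
    simp
  have h1 : ∫ z in Ioc (x - R) (x + R), lam * (x + R) ^ (-p) * φ (x - z) ≤
      ∫ z in Ioc (x - R) (x + R), (φ (x + z) + φ (x - z)) * K z := by
    refine setIntegral_mono_on_ae ?_ (hi.mono_set hsub) measurableSet_Ioc ?_
    · exact (by fun_prop : Continuous fun z => lam * (x + R) ^ (-p) * φ (x - z)).integrableOn_Ioc
    · filter_upwards [hlb] with z hz hzm
      have hz0 : 0 < z := hδ.trans (hsub hzm)
      have hpow : (x + R) ^ (-p) ≤ z ^ (-p) :=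
        Real.rpow_le_rpow_of_nonpos hz0 hzm.2 (by linarith)
      have hKz : lam * (x + R) ^ (-p) ≤ K z := (mul_le_mul_of_nonneg_left hpow hlam).trans (hz hz0)
      have hc : 0 ≤ lam * (x + R) ^ (-p) :=
        mul_nonneg hlam (Real.rpow_nonneg (hz0.le.trans hzm.2) _)
      rw [mul_comm (φ (x + z) + φ (x - z))]
      exact mul_le_mul hKz (by linarith [hφ0 (x + z)]) (hφ0 _) (hc.trans hKz)
  have h2 : ∫ z in Ioc (x - R) (x + R), (φ (x + z) + φ (x - z)) * K z ≤
      ∫ z in Ioi δ, (φ (x + z) + φ (x - z)) * K z := by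
    refine setIntegral_mono_set hi ?_ hsub.eventuallyLE
    rw [EventuallyLE, ae_restrict_iff' measurableSet_Ioi]
    filter_upwards [hlb] with z hz hzm
    have hz0 : 0 < z := hδ.trans hzm
    exact mul_nonneg (add_nonneg (hφ0 _) (hφ0 _))
      ((mul_nonneg hlam (Real.rpow_nonneg hz0.le _)).trans (hz hz0))
  have h3 : ∫ z in Ioi δ, (φ (x + z) + φ (x - z) - 2 * φ x) * K z =
      (∫ z in Ioi δ, (φ (x + z) + φ (x - z)) * K z) - 2 * φ x * ∫ z in Ioi δ, K z := by
    rw [← integral_const_mul, ← integral_sub hi (hKi.const_mul _)]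
    congr 1
    ext z
    ring
  have h4 := mul_le_mul_of_nonneg_left hKle (mul_nonneg zero_le_two (hφ0 x))
  rw [h3, hwindow]
  linarith

/-- Lower asymptotic bound at `+∞` in terms of the mass of `φ` in a bounded window. -/
theorem eventually_atTop_le_rpow_mul_LK {φ K S : ℝ → ℝ} (hφ : Differentiable ℝ φ)
    (hφ0 : ∀ y, 0 ≤ φ y) {L M R p lam Lam c : ℝ}
    (hL : ∀ a b : ℝ, |deriv φ a - deriv φ b| ≤ L * |a - b|) (hM : ∀ y, |φ y| ≤ M)
    (hK : Measurable K) (heven : ∀ᵐ z : ℝ, K (-z) = K z) (hR : 0 ≤ R) (hp : 1 < p) (hp3 : p < 3)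
    (hlam : 0 ≤ lam) (hlb : ∀ᵐ z : ℝ, 0 < z → lam * z ^ (-p) ≤ K z)
    (hub : ∀ᵐ z : ℝ, 0 < z → |K z| ≤ Lam * z ^ (-p))
    (hdecay : Tendsto (fun x => x * φ x) atTop (𝓝 0))
    (hS : ∀ x > 0, ∀ a ∈ Ioo (x / 2) (3 * x / 2), ∀ b ∈ Ioo (x / 2) (3 * x / 2),
      |deriv φ a - deriv φ b| ≤ S x * |a - b|)
    (hSlim : Tendsto (fun x => x ^ 3 * S x) atTop (𝓝 0))
    (hc : c < lam * ∫ y in (-R)..R, φ y) :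
    ∀ᶠ x in atTop, c ≤ x ^ p * LK K φ x := by
  have hratio : Tendsto (fun x : ℝ => (x / (x + R)) ^ p) atTop (𝓝 1) := by
    have h1 : Tendsto (fun x : ℝ => 1 - R / (x + R)) atTop (𝓝 (1 - 0)) :=
      tendsto_const_nhds.sub
        (tendsto_const_nhds.div_atTop (tendsto_id.atTop_add tendsto_const_nhds))
    rw [sub_zero] at h1
    have h2 : Tendsto (fun x : ℝ => x / (x + R)) atTop (𝓝 1) := by
      refine h1.congr' ?_
      filter_upwards [eventually_gt_atTop 0] with x hx
      have : x + R ≠ 0 := by positivity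
      field_simp
      ring
    simpa using h2.rpow_const (p := p) (Or.inl one_ne_zero)
  have hlim : Tendsto (fun x : ℝ => (x / (x + R)) ^ p * (lam * ∫ y in (-R)..R, φ y)
      - (2 * Lam * (1 / 2) ^ (1 - p) / (p - 1)) * (x * φ x)
      - (2 * Lam * (1 / 2) ^ (3 - p) / (3 - p)) * (x ^ 3 * S x)) atTop
      (𝓝 (lam * ∫ y in (-R)..R, φ y)) := by
    have := ((hratio.mul_const (lam * ∫ y in (-R)..R, φ y)).sub
      (hdecay.const_mul (2 * Lam * (1 / 2) ^ (1 - p) / (p - 1)))).sub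
      (hSlim.const_mul (2 * Lam * (1 / 2) ^ (3 - p) / (3 - p)))
    simpa using this
  filter_upwards [hlim.eventually (lt_mem_nhds hc), eventually_gt_atTop 0,
    eventually_ge_atTop (2 * R)] with x hxc hx hxR
  refine hxc.le.trans ?_
  have hδ : 0 < x / 2 := by positivity
  have hnear := near_integral_ge (K := K) (p := p) (Lam := Lam) (S := S x) (x := x) hφ hδ hp3
    (by
      rw [show x - x / 2 = x / 2 by ring, show x + x / 2 = 3 * x / 2 by ring]
      exact hS x hx) hub
  have hfar := far_integral_ge (x := x) hφ.continuous hφ0 hM hK hδ hR (by linarith) hp hlam hlb hub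
  have hsplit : LK K φ x = (∫ z in Ioc 0 (x / 2), (φ (x + z) + φ (x - z) - 2 * φ x) * K z)
      + ∫ z in Ioi (x / 2), (φ (x + z) + φ (x - z) - 2 * φ x) * K z := by
    have hi := integrableOn_second_difference_mul hφ hL hM hK hp hp3 hub x
    rw [LK_eq_integral hφ hL hM hK heven hp hp3 hub, ← Ioc_union_Ioi_eq_Ioi hδ.le] at *
    exact setIntegral_union Ioc_disjoint_Ioi_same measurableSet_Ioi
      (hi.mono_set subset_union_left) (hi.mono_set subset_union_right)
  have hpow (q : ℝ) : x ^ p * (x / 2) ^ (q - p) =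
      x ^ q * (1 / 2) ^ (q - p) := by
    rw [div_eq_mul_one_div x, Real.mul_rpow hx.le (by norm_num), ← mul_assoc, ← Real.rpow_add hx,
      add_sub_cancel]
  have hp1 := hpow 1
  have hp2 := hpow 3
  have hp0 : x ^ p * (x + R) ^ (-p) = (x / (x + R)) ^ p := by
    rw [Real.div_rpow hx.le (by positivity), Real.rpow_neg (by positivity), div_eq_mul_inv]
  rw [Real.rpow_one] at hp1
  rw [show (3 : ℝ) = ((3 : ℕ) : ℝ) by norm_num, Real.rpow_natCast, Nat.cast_ofNat] at hp2
  rw [hsplit]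
  calc _ = x ^ p * (-(2 * S x * Lam * ((x / 2) ^ (3 - p) / (3 - p))) +
        (lam * (x + R) ^ (-p) * (∫ y in (-R)..R, φ y)
          - 2 * φ x * (Lam * ((x / 2) ^ (1 - p) / (p - 1))))) := by
        rw [← hp0]
        linear_combination (2 * Lam * S x / (3 - p)) * hp2 + (2 * Lam * φ x / (p - 1)) * hp1
    _ ≤ _ := mul_le_mul_of_nonneg_left (add_le_add hnear hfar) (by positivity)

theorem tail_integral_ge {φ : ℝ → ℝ} (hφ : Continuous φ) {C κ τ R : ℝ} (hκ : 0 < κ) (hτ : 1 < τ)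
    (hlo : ∀ x > κ, C * |x| ^ (-τ) ≤ φ x) (hR : κ ≤ R) :
    C * ((κ ^ (1 - τ) - R ^ (1 - τ)) / (τ - 1)) ≤ ∫ y in κ..R, φ y := by
  have h0 : (0 : ℝ) ∉ uIcc κ R := by
    rw [uIcc_of_le hR]; exact fun h => absurd h.1 (not_le.2 hκ)
  have h1 : ∫ y in κ..R, C * y ^ (-τ) = C * ((κ ^ (1 - τ) - R ^ (1 - τ)) / (τ - 1)) := by
    rw [intervalIntegral.integral_const_mul, integral_rpow (Or.inr ⟨by linarith, h0⟩),
      neg_add_eq_sub, ← neg_sub τ 1, div_neg, ← neg_div, neg_sub]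
  rw [← h1]
  refine intervalIntegral.integral_mono_on_of_le_Ioo hR
    ((intervalIntegral.intervalIntegrable_rpow (Or.inr h0)).const_mul C)
    (hφ.intervalIntegrable _ _) fun y hy => ?_
  simpa [abs_of_pos (hκ.trans hy.1)] using hlo y hy.1

/-- The mass of `φ` in a large window nearly exceeds the sum of its core mass and tail bounds. -/
theorem exists_window_integral_gt {φ : ℝ → ℝ} (hφ : Continuous φ) {C κ σ τ lam c : ℝ}
    (hκ : 0 < κ) (hσ : 1 < σ) (hτ : 1 < τ) (hlam : 0 ≤ lam)
    (hlo1 : ∀ x < -κ, C * |x| ^ (-σ) ≤ φ x) (hlo2 : ∀ x > κ, C * |x| ^ (-τ) ≤ φ x)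
    (hc : c < lam * (C * κ ^ (1 - σ) / (σ - 1) + (∫ y in (-κ)..κ, φ y)
      + C * κ ^ (1 - τ) / (τ - 1))) :
    ∃ R, 0 ≤ R ∧ c < lam * ∫ y in (-R)..R, φ y := by
  have hpow {q : ℝ} (hq : 1 < q) : Tendsto (fun R : ℝ => C * ((κ ^ (1 - q) - R ^ (1 - q)) / (q - 1)))
      atTop (𝓝 (C * κ ^ (1 - q) / (q - 1))) := by
    have h := tendsto_rpow_neg_atTop (y := q - 1) (by linarith)
    rw [neg_sub] at h
    simpa [mul_div_assoc] using
      ((tendsto_const_nhds (x := κ ^ (1 - q)).sub h).div_const (q - 1)).const_mul C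
  have hlim := (((hpow hσ).add_const (∫ y in (-κ)..κ, φ y)).add (hpow hτ)).const_mul lam
  obtain ⟨R, hRc, hR⟩ := ((hlim.eventually (lt_mem_nhds hc)).and (eventually_ge_atTop κ)).exists
  refine ⟨R, hκ.le.trans hR, hRc.trans_le (mul_le_mul_of_nonneg_left ?_ hlam)⟩
  have h2 := tail_integral_ge hφ hκ hτ hlo2 hR
  have h1 := tail_integral_ge (φ := fun y => φ (-y)) (by fun_prop) hκ hσ
    (fun x hx => by simpa using hlo1 (-x) (by linarith)) hR
  rw [intervalIntegral.integral_comp_neg] at h1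
  have hii (a b : ℝ) : IntervalIntegrable φ volume a b := hφ.intervalIntegrable a b
  rw [← intervalIntegral.integral_add_adjacent_intervals (hii (-R) κ) (hii κ R),
    ← intervalIntegral.integral_add_adjacent_intervals (hii (-R) (-κ)) (hii (-κ) κ)]
  linarith

/-- For a Lipschitz function, the supremum of the absolute derivative over an open interval is a
Lipschitz constant there. -/
theorem abs_sub_le_sSup_abs_deriv_mul {f : ℝ → ℝ} {L : ℝ}
    (hL : ∀ x y : ℝ, |f x - f y| ≤ L * |x - y|) {u v a b : ℝ} (ha : a ∈ Ioo u v)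
    (hb : b ∈ Ioo u v) :
    |f a - f b| ≤ sSup ((fun y => |deriv f y|) '' Ioo u v) * |a - b| := by
  have hL0 : 0 ≤ L := by
    have := (abs_nonneg _).trans (hL 1 0)
    simpa using this
  have hlip : LipschitzWith L.toNNReal f := LipschitzWith.of_dist_le_mul fun x y => by
    simpa [Real.dist_eq, hL0] using hL x y
  have hbdd : BddAbove ((fun y => |deriv f y|) '' Ioo u v) := by
    refine ⟨L, ?_⟩
    rintro _ ⟨y, _, rfl⟩
    simpa [hL0] using norm_deriv_le_of_lipschitz hlip (x₀ := y)
  rw [← (hlip.lipschitzOnWith (s := uIcc b a)).absolutelyContinuousOnInterval.integral_deriv_eq_sub]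
  rw [← Real.norm_eq_abs]
  refine intervalIntegral.norm_integral_le_of_norm_le_const fun y hy => ?_
  exact le_csSup hbdd ⟨y, ordConnected_Ioo.uIcc_subset hb ha (uIoc_subset_uIcc hy), rfl⟩

/-- A continuous function with `|x| φ(x) → 0` at infinity is bounded. -/
theorem exists_bound_of_tendsto_abs_mul {φ : ℝ → ℝ} (hφ : Continuous φ)
    (hdecay : Tendsto (fun x : ℝ => |x| * φ x) (cocompact ℝ) (𝓝 0)) : ∃ M, ∀ x, |φ x| ≤ M := by
  have h1 : ∀ᶠ x : ℝ in cocompact ℝ, |φ x| ≤ 1 := by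
    filter_upwards [hdecay.eventually (Metric.ball_mem_nhds 0 one_pos),
      tendsto_norm_cocompact_atTop.eventually_ge_atTop 1] with x hx hx1
    rw [dist_zero_right, norm_mul, Real.norm_eq_abs, abs_abs, Real.norm_eq_abs] at hx
    rw [Real.norm_eq_abs] at hx1
    nlinarith [abs_nonneg (φ x)]
  obtain ⟨t, ht, hsub⟩ := mem_cocompact.1 h1
  obtain ⟨C, hC⟩ := ht.exists_bound_of_continuousOn hφ.continuousOn
  refine ⟨max C 1, fun x => ?_⟩
  by_cases hx : x ∈ t
  · exact (hC x hx).trans (le_max_left _ _)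
  · exact (hsub hx : |φ x| ≤ 1).trans (le_max_right _ _)

theorem lower_asymptotic_bound (s lam Lam : ℝ)
    (hs : s ∈ Set.Ioo (0:ℝ) 1) (hlam : 0 < lam) (hlL : lam ≤ Lam)
    (K : ℝ → ℝ) (hKmeas : Measurable K)
    (hK1 : ∀ᵐ x : ℝ, K (-x) = K x)
    (hK2 : ∀ᵐ x : ℝ, lam / |x| ^ (1 + 2*s) ≤ K x ∧ K x ≤ Lam / |x| ^ (1 + 2*s))
    (Cb κ σ τ γ : ℝ) (hCb : 0 < Cb) (hκ : 0 < κ) (hσ : 1 < σ) (hτ : 1 < τ) (hγ : 0 < γ)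
    -- φ ∈ C^{1,1}(ℝ): differentiable with bounded Lipschitz derivative
    (φ : ℝ → ℝ) (hφdiff : Differentiable ℝ φ)
    (hφ'bdd : ∃ M : ℝ, ∀ x, |deriv φ x| ≤ M)
    (hφ'lip : ∃ L : ℝ, ∀ x y : ℝ, |deriv φ x - deriv φ y| ≤ L * |x - y|)
    (hlo1 : ∀ x < -κ, Cb * |x| ^ (-σ) ≤ φ x)
    (hlo2 : ∀ x > κ, Cb * |x| ^ (-τ) ≤ φ x)
    (hlow : ∀ x ∈ Set.Icc (-κ) κ, γ ≤ φ x)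
    (hdecay : Tendsto (fun x : ℝ => |x| * φ x) (cocompact ℝ) (𝓝 0))
    (hsec1 : Tendsto (fun x : ℝ =>
        x ^ 3 * sSup ((fun y => |deriv (deriv φ) y|) '' Set.Ioo (x/2) (3*x/2)))
      atTop (𝓝 0))
    (hsec2 : Tendsto (fun x : ℝ =>
        |x| ^ 3 * sSup ((fun y => |deriv (deriv φ) y|) '' Set.Ioo (3*x/2) (x/2)))
      atBot (𝓝 0)) :
    -- liminf_{|x|→∞} |x|^{1+2s} L_K φ(x) ≥ λ (C̄κ^{1-σ}/(σ-1) + ∫_{-κ}^{κ} φ + C̄κ^{1-τ}/(τ-1))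
    ∀ c < lam * (Cb * κ ^ (1-σ) / (σ-1) + (∫ y in (-κ)..κ, φ y) + Cb * κ ^ (1-τ) / (τ-1)),
      ∀ᶠ x in cocompact ℝ, c ≤ |x| ^ (1 + 2*s) * LK K φ x := by
  intro c hc
  obtain ⟨L, hL⟩ := hφ'lip
  obtain ⟨M, hM⟩ := exists_bound_of_tendsto_abs_mul hφdiff.continuous hdecay
  have hp : 1 < 1 + 2 * s := by linarith [hs.1]
  have hp3 : 1 + 2 * s < 3 := by linarith [hs.2]
  have hφ0 : ∀ y, 0 ≤ φ y := fun y => by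
    rcases lt_or_ge y (-κ) with h | h
    · exact (by positivity : 0 ≤ Cb * |y| ^ (-σ)).trans (hlo1 y h)
    rcases le_or_gt y κ with h' | h'
    · exact hγ.le.trans (hlow y ⟨h, h'⟩)
    · exact (by positivity : 0 ≤ Cb * |y| ^ (-τ)).trans (hlo2 y h')
  have hlb : ∀ᵐ z : ℝ, 0 < z → lam * z ^ (-(1 + 2 * s)) ≤ K z := by
    filter_upwards [hK2] with z hz hz0
    rw [Real.rpow_neg hz0.le, ← div_eq_mul_inv]
    simpa only [abs_of_pos hz0] using hz.1
  have hub : ∀ᵐ z : ℝ, 0 < z → |K z| ≤ Lam * z ^ (-(1 + 2 * s)) := by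
    filter_upwards [hK2, hlb] with z hz hzl hz0
    rw [abs_of_nonneg ((by positivity : 0 ≤ lam * z ^ (-(1 + 2 * s))).trans (hzl hz0))]
    rw [Real.rpow_neg hz0.le, ← div_eq_mul_inv]
    simpa only [abs_of_pos hz0] using hz.2
  obtain ⟨R, hR, hRc⟩ :=
    exists_window_integral_gt hφdiff.continuous hκ hσ hτ hlam.le hlo1 hlo2 hc
  rw [cocompact_eq_atBot_atTop] at hdecay ⊢
  obtain ⟨hdecay1, hdecay2⟩ := tendsto_sup.1 hdecay
  refine eventually_sup.2 ⟨?_, ?_⟩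
  · have hψ : Differentiable ℝ fun y => φ (-y) := hφdiff.comp differentiable_neg
    have hψ' (a b : ℝ) : |deriv (fun y => φ (-y)) a - deriv (fun y => φ (-y)) b| =
        |deriv φ (-a) - deriv φ (-b)| := by
      rw [deriv_comp_neg, deriv_comp_neg, ← abs_neg]
      congr 1
      ring
    have habs (a b : ℝ) : |-a - -b| = |a - b| := by rw [neg_sub_neg, abs_sub_comm]
    have hψL (a b : ℝ) : |deriv (fun y => φ (-y)) a - deriv (fun y => φ (-y)) b| ≤ L * |a - b| := by
      rw [hψ', ← habs a b]; exact hL _ _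
    have hev := eventually_atTop_le_rpow_mul_LK (φ := fun y => φ (-y)) (c := c)
      (S := fun x => sSup ((fun y => |deriv (deriv φ) y|) '' Ioo (3 * (-x) / 2) ((-x) / 2)))
      hψ (fun y => hφ0 (-y)) hψL (fun y => hM (-y)) hKmeas hK1 hR hp hp3 hlam.le hlb hub
      ((hdecay1.comp tendsto_neg_atTop_atBot).congr' (by
        filter_upwards [eventually_gt_atTop 0] with x hx
        simp [abs_of_pos hx]))
      (fun x _ a ha b hb => by
        rw [hψ', ← habs a b]
        exact abs_sub_le_sSup_abs_deriv_mul hL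
          ⟨by linarith [ha.2], by linarith [ha.1]⟩ ⟨by linarith [hb.2], by linarith [hb.1]⟩)
      ((hsec2.comp tendsto_neg_atTop_atBot).congr' (by
        filter_upwards [eventually_gt_atTop 0] with x hx
        simp only [Function.comp_apply, abs_neg, abs_of_pos hx]))
      (by simpa [intervalIntegral.integral_comp_neg] using hRc)
    filter_upwards [tendsto_neg_atBot_atTop.eventually hev, eventually_lt_atBot 0] with x hx hx0
    rw [LK_eq_integral hψ hψL (fun y => hM (-y)) hKmeas hK1 hp hp3 hub] at hx
    rw [abs_of_neg hx0, LK_eq_integral hφdiff hL hM hKmeas hK1 hp hp3 hub]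
    convert hx using 5 with z
    rw [neg_neg, neg_sub, sub_neg_eq_add, neg_add, neg_neg, ← sub_eq_add_neg, add_comm z x]
    ring
  · have hev := eventually_atTop_le_rpow_mul_LK (c := c) hφdiff hφ0 hL hM hKmeas hK1 hR hp hp3
      hlam.le hlb hub
      (hdecay2.congr' (by
        filter_upwards [eventually_gt_atTop 0] with x hx
        rw [abs_of_pos hx]))
      (fun x _ a ha b hb => abs_sub_le_sSup_abs_deriv_mul hL ha hb) hsec1 hRc
    filter_upwards [hev, eventually_gt_atTop 0] with x hx hx0
    rwa [abs_of_pos hx0]
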